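/- Let A be the symmetric adjacency matrix of the multigraph obtained from the doubly extended 4442 base graph by adding one new vertex y joined to x₂ by a double edge (so the (y,x₂) and (x₂,y) entries of A equal 2). Then A has an eigenvalue strictly larger than √(3+√5): there exist a real number μ > √(3+√5) and a nonzero real vector v with A·v = μ·v. -/

import Mathlib

open Matrix

/-- Doubly extended 4442 base graph; vertex 13 is joined to 11 by a double edge. -/
def edgesDoubleDExt4442 : List (Fin 14 × Fin 14) :=
  [(0,1),(1,2),(2,3),(3,4),(4,5),(4,6),(4,7),(5,8),(6,9),(7,10),(9,11),(10,12)]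

/-- Adjacency matrix of the multigraph: entry is the number of edges between the vertices;
the pair (11, 13) is joined by a double edge. -/
def adjDoubleDExt4442 : Matrix (Fin 14) (Fin 14) ℝ :=
  fun i j =>
    if (i, j) ∈ edgesDoubleDExt4442 ∨ (j, i) ∈ edgesDoubleDExt4442 then 1
    else if (i, j) = (11, 13) ∨ (i, j) = (13, 11) then 2
    else 0

/-- The characteristic polynomial of the multigraph, written by expanding at the
vertex `4` and its four arms. -/
def charDoubleDExt4442 (t : ℝ) : ℝ :=
  t * ((t ^ 4 - 3 * t ^ 2 + 1) * (t ^ 2 - 1) * (t ^ 3 - 2 * t) * (t ^ 4 - 6 * t ^ 2 + 4))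
    - (t ^ 3 - 2 * t) * (t ^ 2 - 1) * (t ^ 3 - 2 * t) * (t ^ 4 - 6 * t ^ 2 + 4)
    - t * (t ^ 4 - 3 * t ^ 2 + 1) * (t ^ 3 - 2 * t) * (t ^ 4 - 6 * t ^ 2 + 4)
    - (t ^ 2 - 1) * (t ^ 4 - 3 * t ^ 2 + 1) * (t ^ 2 - 1) * (t ^ 4 - 6 * t ^ 2 + 4)
    - (t ^ 3 - 5 * t) * (t ^ 4 - 3 * t ^ 2 + 1) * (t ^ 2 - 1) * (t ^ 3 - 2 * t)

/-- An eigenvector for the eigenvalue `t` whenever `t` is a root of `charDoubleDExt4442`. -/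
def eigvecDoubleDExt4442 (t : ℝ) : Fin 14 → ℝ :=
  let p₂ := t ^ 2 - 1
  let p₃ := t ^ 3 - 2 * t
  let p₄ := t ^ 4 - 3 * t ^ 2 + 1
  let q := t ^ 4 - 6 * t ^ 2 + 4
  ![p₂ * p₃ * q, t * (p₂ * p₃ * q), p₂ * (p₂ * p₃ * q), p₃ * (p₂ * p₃ * q), p₄ * p₂ * p₃ * q,
    t * (p₄ * p₃ * q), (t ^ 3 - 5 * t) * (p₄ * p₂ * p₃), p₂ * (p₄ * p₂ * q),
    p₄ * p₃ * q, (t ^ 2 - 4) * (p₄ * p₂ * p₃), t * (p₄ * p₂ * q),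
    t * (p₄ * p₂ * p₃), p₄ * p₂ * q, 2 * (p₄ * p₂ * p₃)]

theorem adjDoubleDExt4442_mulVec_eigvec {t : ℝ} (ht : charDoubleDExt4442 t = 0) :
    adjDoubleDExt4442.mulVec (eigvecDoubleDExt4442 t) = t • eigvecDoubleDExt4442 t := by
  unfold charDoubleDExt4442 at ht
  funext i
  fin_cases i <;>
    simp [Matrix.mulVec, dotProduct, Fin.sum_univ_succ, adjDoubleDExt4442, edgesDoubleDExt4442,
      eigvecDoubleDExt4442] <;>
    first
      | ring1
      | linear_combination -ht

theorem armFactors_pos {t : ℝ} (ht : 0 < t) (h : 5 < t ^ 2) :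
    0 < (t ^ 4 - 3 * t ^ 2 + 1) * (t ^ 2 - 1) * (t ^ 3 - 2 * t) := by
  have h₄ : 0 < t ^ 4 - 3 * t ^ 2 + 1 := by nlinarith
  have h₂ : 0 < t ^ 2 - 1 := by linarith
  have h₃ : 0 < t ^ 3 - 2 * t := by nlinarith
  positivity

theorem charDoubleDExt4442_neg : charDoubleDExt4442 √(3 + √5) < 0 := by
  have hs : √5 ^ 2 = 5 := Real.sq_sqrt (by norm_num)
  have hs₂ : 2 < √5 := Real.lt_sqrt_of_sq_lt (by norm_num)
  have ha : √(3 + √5) ^ 2 = 3 + √5 := Real.sq_sqrt (by positivity)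
  have ha₀ : 0 < √(3 + √5) := by positivity
  set a := √(3 + √5)
  have hq : a ^ 4 - 6 * a ^ 2 + 4 = 0 := by
    linear_combination (a ^ 2 + √5 - 3) * ha + hs
  have h₅ : 0 < a ^ 3 - 5 * a := by nlinarith
  have hpos := mul_pos h₅ (armFactors_pos ha₀ (by linarith))
  unfold charDoubleDExt4442
  rw [hq]
  linarith

theorem thmDoubleDExt4442 :
    ∃ μ : ℝ, μ > Real.sqrt (3 + Real.sqrt 5) ∧
      ∃ v : Fin 14 → ℝ, v ≠ 0 ∧ (adjDoubleDExt4442).mulVec v = μ • v := by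
  have hs₂ : 2 < √5 := Real.lt_sqrt_of_sq_lt (by norm_num)
  have hs₃ : √5 < 3 := (Real.sqrt_lt' (by norm_num)).2 (by norm_num)
  have ha : √(3 + √5) ^ 2 = 3 + √5 := Real.sq_sqrt (by positivity)
  have ha₃ : √(3 + √5) ≤ 3 := Real.sqrt_le_iff.2 ⟨by norm_num, by linarith⟩
  have hcont : ContinuousOn charDoubleDExt4442 (Set.Icc √(3 + √5) 3) := by
    unfold charDoubleDExt4442
    fun_prop
  have h₃ : 0 < charDoubleDExt4442 3 := by norm_num [charDoubleDExt4442]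
  obtain ⟨μ, hμ, hroot⟩ := intermediate_value_Ioo ha₃ hcont ⟨charDoubleDExt4442_neg, h₃⟩
  refine ⟨μ, hμ.1, eigvecDoubleDExt4442 μ, fun hzero => ?_,
    adjDoubleDExt4442_mulVec_eigvec hroot⟩
  have hμ₀ : 0 < μ := (Real.sqrt_nonneg _).trans_lt hμ.1
  have hsq : 5 < μ ^ 2 := by
    nlinarith [hμ.1, Real.sqrt_nonneg (3 + √5)]
  have hpos := armFactors_pos hμ₀ hsq
  have hy : 2 * ((μ ^ 4 - 3 * μ ^ 2 + 1) * (μ ^ 2 - 1) * (μ ^ 3 - 2 * μ)) = 0 :=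
    congrFun hzero 13
  linarith
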